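/- For each t > 0, x ∈ ℝ and y > 0 define θ(t; x, y) = Σ_{(m,n) ∈ ℤ² \ {(0,0)}} exp(−(t/y)·((m + n·x)² + n²·y²)). Then for every t > 0, every y ≥ 1/2 and every x with 0 < x < 1/2, the partial derivative ∂θ/∂x (t; x, y) is strictly negative. -/

import Mathlib

noncomputable section

/-- `θ(t; x, y) = ∑_{(m,n) ∈ ℤ²\{0}} exp (-(t/y)((m + n x)² + n² y²))`,
which is `F_t` of the unimodular lattice associated to `z = x + i y`. -/
def theta (t x y : ℝ) : ℝ :=
  ∑' p : {p : ℤ × ℤ // p ≠ (0, 0)},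
    Real.exp (-(t / y) * (((p.1.1 : ℝ) + (p.1.2 : ℝ) * x) ^ 2 + (p.1.2 : ℝ) ^ 2 * y ^ 2))

open Real

lemma abs_sin_nat_mul_le (n : ℕ) (x : ℝ) : |sin (n * x)| ≤ n * |sin x| := by
  induction n with
  | zero => simp
  | succ k ih =>
    push_cast
    rw [add_mul, one_mul, sin_add]
    calc |sin (k * x) * cos x + cos (k * x) * sin x|
        ≤ |sin (k * x) * cos x| + |cos (k * x) * sin x| := abs_add_le _ _
      _ = |sin (k * x)| * |cos x| + |cos (k * x)| * |sin x| := by rw [abs_mul, abs_mul]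
      _ ≤ |sin (k * x)| * 1 + 1 * |sin x| := by
          gcongr
          · exact abs_cos_le_one _
          · exact abs_cos_le_one _
      _ ≤ (k + 1) * |sin x| := by linarith

lemma sq_exp_term_le {a : ℝ} (ha : 0 < a) (n : ℕ) :
    ((n : ℝ) + 1) ^ 2 * exp (-a * ((n : ℝ) + 1) ^ 2) ≤
      (2 / a * exp (-(a / 2))) * exp (-(a / 2)) ^ n := by
  set s : ℝ := (n : ℝ) + 1 with hs
  have hs1 : 1 ≤ s := by simp [hs]
  have h1 : a / 2 * s ^ 2 ≤ exp (a / 2 * s ^ 2) := by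
    linarith [add_one_le_exp (a / 2 * s ^ 2)]
  have h2 : s ^ 2 ≤ 2 / a * exp (a / 2 * s ^ 2) := by
    calc s ^ 2 = 2 / a * (a / 2 * s ^ 2) := by field_simp
      _ ≤ _ := by gcongr
  have h3 : exp (-(a / 2)) * exp (-(a / 2)) ^ n = exp (-(a / 2) * s) := by
    rw [← exp_nat_mul, ← exp_add]; congr 1; rw [hs]; ring
  calc s ^ 2 * exp (-a * s ^ 2) ≤ 2 / a * exp (a / 2 * s ^ 2) * exp (-a * s ^ 2) := by gcongr
    _ = 2 / a * exp (-(a / 2) * s ^ 2) := by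
        rw [mul_assoc, ← exp_add]; congr 2; ring
    _ ≤ 2 / a * exp (-(a / 2) * s) := by
        have : -(a / 2) * s ^ 2 ≤ -(a / 2) * s := by
          nlinarith [mul_nonneg ha.le (mul_nonneg (by linarith : (0:ℝ) ≤ s) (by linarith : (0:ℝ) ≤ s - 1))]
        gcongr
    _ = _ := by rw [mul_assoc, h3]

lemma exp_half_lt_one {a : ℝ} (ha : 0 < a) : exp (-(a / 2)) < 1 := by
  rw [exp_lt_one_iff]; linarith

lemma summable_sq_exp {a : ℝ} (ha : 0 < a) :
    Summable fun n : ℕ => ((n : ℝ) + 1) ^ 2 * exp (-a * ((n : ℝ) + 1) ^ 2) :=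
  Summable.of_nonneg_of_le (fun n => by positivity) (sq_exp_term_le ha)
    ((summable_geometric_of_lt_one (exp_pos _).le (exp_half_lt_one ha)).mul_left _)

lemma tsum_sq_exp_le {a : ℝ} (ha : 0 < a) :
    ∑' n : ℕ, ((n : ℝ) + 1) ^ 2 * exp (-a * ((n : ℝ) + 1) ^ 2) ≤ 4 / a ^ 2 := by
  have hr := exp_half_lt_one ha
  calc _ ≤ ∑' n : ℕ, (2 / a * exp (-(a / 2))) * exp (-(a / 2)) ^ n :=
        (summable_sq_exp ha).tsum_le_tsum (sq_exp_term_le ha)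
          ((summable_geometric_of_lt_one (exp_pos _).le hr).mul_left _)
    _ = (2 / a * exp (-(a / 2))) * (1 - exp (-(a / 2)))⁻¹ := by
        rw [tsum_mul_left, tsum_geometric_of_lt_one (exp_pos _).le hr]
    _ ≤ 4 / a ^ 2 := by
        have h1 : (a / 2) * exp (-(a / 2)) ≤ 1 - exp (-(a / 2)) := by
          have := add_one_le_exp (a / 2)
          have h2 : exp (a / 2) * exp (-(a / 2)) = 1 := by rw [← exp_add]; simp
          nlinarith [exp_pos (-(a / 2))]
        have h3 : 0 < 1 - exp (-(a / 2)) := by linarith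
        rw [← div_eq_mul_inv, div_le_iff₀ h3]
        calc 2 / a * exp (-(a / 2)) = 4 / a ^ 2 * (a / 2 * exp (-(a / 2))) := by
              field_simp; ring
          _ ≤ _ := by gcongr

lemma exp_num_bound {a : ℝ} (ha : 0.7 ≤ a) : exp (-(4 * a)) ≤ 1 / 15 := by
  have h : exp (-(4 * a)) ≤ exp (-2.8) := by gcongr; linarith
  refine h.trans ?_
  rw [exp_neg, inv_eq_one_div]
  apply one_div_le_one_div_of_le (by norm_num)
  have h2 : (2.8 : ℝ) = 2 + 0.8 := by norm_num
  rw [h2, exp_add]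
  have h3 : exp 2 = exp 1 * exp 1 := by rw [← exp_add]; norm_num
  have h4 := exp_one_gt_d9
  have h5 := quadratic_le_exp_of_nonneg (x := (0.8 : ℝ)) (by norm_num)
  rw [h3]
  have h6 : (2.7 : ℝ) * 2.7 ≤ exp 1 * exp 1 := by gcongr <;> linarith
  have h7 : (2.12 : ℝ) ≤ exp 0.8 := by linarith
  calc (15 : ℝ) ≤ (2.7 * 2.7) * 2.12 := by norm_num
    _ ≤ _ := by gcongr

lemma tail_term_le {a : ℝ} (ha : 0.7 ≤ a) (j : ℕ) :
    ((j : ℝ) + 2) ^ 2 * exp (-a * ((j : ℝ) + 2) ^ 2) ≤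
      (4 * exp (-(3 * a)) * exp (-a)) * (3 / 20) ^ j := by
  have h1 : ((j : ℝ) + 2) ^ 2 ≤ 4 * (9 / 4) ^ j := by
    induction j with
    | zero => norm_num
    | succ k ih =>
      push_cast
      rw [pow_succ (9 / 4 : ℝ)]
      nlinarith [(Nat.cast_nonneg k : (0:ℝ) ≤ k)]
  have h2 : exp (-a * ((j : ℝ) + 2) ^ 2) ≤ exp (-(3 * a)) * exp (-a) * exp (-(4 * a)) ^ j := by
    rw [← exp_nat_mul, ← exp_add, ← exp_add]
    gcongr
    nlinarith [(Nat.cast_nonneg j : (0:ℝ) ≤ j), sq_nonneg (j : ℝ)]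
  have h3 := exp_num_bound ha
  calc _ ≤ 4 * (9 / 4) ^ j * (exp (-(3 * a)) * exp (-a) * exp (-(4 * a)) ^ j) := by gcongr
    _ ≤ 4 * (9 / 4) ^ j * (exp (-(3 * a)) * exp (-a) * (1 / 15) ^ j) := by gcongr
    _ = (4 * exp (-(3 * a)) * exp (-a)) * ((9 / 4) ^ j * (1 / 15) ^ j) := by ring
    _ = _ := by rw [← mul_pow]; norm_num

lemma summable_tail {a : ℝ} (ha : 0.7 ≤ a) :
    Summable fun j : ℕ => ((j : ℝ) + 2) ^ 2 * exp (-a * ((j : ℝ) + 2) ^ 2) :=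
  Summable.of_nonneg_of_le (fun n => by positivity) (tail_term_le ha)
    ((summable_geometric_of_lt_one (by norm_num) (by norm_num)).mul_left _)

lemma tsum_tail_le {a : ℝ} (ha : 0.7 ≤ a) :
    ∑' j : ℕ, ((j : ℝ) + 2) ^ 2 * exp (-a * ((j : ℝ) + 2) ^ 2) ≤
      5 * exp (-(3 * a)) * exp (-a) := by
  calc _ ≤ ∑' j : ℕ, (4 * exp (-(3 * a)) * exp (-a)) * (3 / 20) ^ j :=
        (summable_tail ha).tsum_le_tsum (tail_term_le ha)
          ((summable_geometric_of_lt_one (by norm_num) (by norm_num)).mul_left _)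
    _ = (4 * exp (-(3 * a)) * exp (-a)) * (1 - 3 / 20)⁻¹ := by
        rw [tsum_mul_left, tsum_geometric_of_lt_one (by norm_num) (by norm_num)]
    _ ≤ _ := by
        have : 0 < exp (-(3 * a)) * exp (-a) := by positivity
        norm_num
        linarith

/-- Abstract positivity (and quantitative) lemma. -/
lemma tsum_weight_ge {a M : ℝ} (ha : 0.7 ≤ a) (v : ℕ → ℝ)
    (hv : ∀ n : ℕ, |v n| ≤ ((n : ℝ) + 1) * M) :
    Summable (fun n : ℕ => ((n : ℝ) + 1) * exp (-a * ((n : ℝ) + 1) ^ 2) * v n) ∧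
    exp (-a) * (v 0 - M * (5 * exp (-(3 * a)))) ≤
      ∑' n : ℕ, ((n : ℝ) + 1) * exp (-a * ((n : ℝ) + 1) ^ 2) * v n := by
  have hbd : ∀ n : ℕ, |((n : ℝ) + 1) * exp (-a * ((n : ℝ) + 1) ^ 2) * v n| ≤
      M * (((n : ℝ) + 1) ^ 2 * exp (-a * ((n : ℝ) + 1) ^ 2)) := by
    intro n
    rw [abs_mul, abs_of_nonneg (by positivity)]
    calc _ ≤ ((n : ℝ) + 1) * exp (-a * ((n : ℝ) + 1) ^ 2) * (((n : ℝ) + 1) * M) := by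
          gcongr; exact hv n
      _ = _ := by ring
  have hsum : Summable (fun n : ℕ => ((n : ℝ) + 1) * exp (-a * ((n : ℝ) + 1) ^ 2) * v n) :=
    Summable.of_norm_bounded ((summable_sq_exp (by linarith)).mul_left M) hbd
  have hM : 0 ≤ M := by
    have := (abs_nonneg _).trans (hv 0)
    simpa using this
  refine ⟨hsum, ?_⟩
  rw [hsum.tsum_eq_zero_add]
  have h2 : -(M * ∑' j : ℕ, ((j : ℝ) + 2) ^ 2 * exp (-a * ((j : ℝ) + 2) ^ 2)) ≤
      ∑' n : ℕ, (((n + 1 : ℕ) : ℝ) + 1) * exp (-a * (((n + 1 : ℕ) : ℝ) + 1) ^ 2) * v (n + 1) := by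
    rw [← tsum_mul_left, ← tsum_neg]
    refine Summable.tsum_le_tsum ?_ ((summable_tail ha).mul_left M).neg
      ((summable_nat_add_iff 1).2 hsum)
    intro j
    have := neg_le_of_abs_le (hbd (j + 1))
    refine le_trans (le_of_eq ?_) this
    push_cast
    ring_nf
  have h3 := mul_le_mul_of_nonneg_left (tsum_tail_le ha) hM
  have h4 : (((0 : ℕ) : ℝ) + 1) * exp (-a * (((0 : ℕ) : ℝ) + 1) ^ 2) * v 0 = exp (-a) * v 0 := by
    norm_num
  rw [h4]
  nlinarith

def FF (b u : ℝ) : ℝ :=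
  ∑' k : ℕ, ((k : ℝ) + 1) * exp (-b * ((k : ℝ) + 1) ^ 2) * sin (2 * π * ((k : ℝ) + 1) * u)

def QQ (b : ℝ) : ℝ := ∑' n : ℕ, ((n : ℝ) + 1) ^ 2 * exp (-b * ((n : ℝ) + 1) ^ 2)

lemma FF_term_le (b x : ℝ) (n k : ℕ) :
    |((k : ℝ) + 1) * exp (-b * ((k : ℝ) + 1) ^ 2) *
      sin (2 * π * ((k : ℝ) + 1) * (((n : ℝ) + 1) * x))| ≤
    ((n : ℝ) + 1) * |sin (2 * π * x)| * (((k : ℝ) + 1) ^ 2 * exp (-b * ((k : ℝ) + 1) ^ 2)) := by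
  have h := abs_sin_nat_mul_le ((k + 1) * (n + 1)) (2 * π * x)
  push_cast at h
  rw [abs_mul, abs_of_nonneg (by positivity : (0:ℝ) ≤ ((k : ℝ) + 1) * exp (-b * ((k : ℝ) + 1) ^ 2))]
  rw [show 2 * π * ((k : ℝ) + 1) * (((n : ℝ) + 1) * x) =
    ((k : ℝ) + 1) * ((n : ℝ) + 1) * (2 * π * x) by ring]
  calc _ ≤ ((k : ℝ) + 1) * exp (-b * ((k : ℝ) + 1) ^ 2) *
        (((k : ℝ) + 1) * ((n : ℝ) + 1) * |sin (2 * π * x)|) := by gcongr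
    _ = _ := by ring

lemma FF_le {b : ℝ} (hb : 0 < b) (x : ℝ) (n : ℕ) :
    |FF b (((n : ℝ) + 1) * x)| ≤ ((n : ℝ) + 1) * (|sin (2 * π * x)| * QQ b) := by
  unfold FF QQ
  rw [← mul_assoc, ← tsum_mul_left]
  exact tsum_of_norm_bounded (f := fun k : ℕ => ((k : ℝ) + 1) * exp (-b * ((k : ℝ) + 1) ^ 2) *
      sin (2 * π * ((k : ℝ) + 1) * (((n : ℝ) + 1) * x)))
    (((summable_sq_exp hb).mul_left _).hasSum) (FF_term_le b x n)

/-- Case I. -/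
lemma core_I {a b x : ℝ} (ha : 1.5 ≤ a) (hb : 0.7 ≤ b) (hx0 : 0 < x) (hx1 : x < 1 / 2) :
    0 < ∑' n : ℕ, ((n : ℝ) + 1) * exp (-a * ((n : ℝ) + 1) ^ 2) * FF b (((n : ℝ) + 1) * x) := by
  have hs : 0 < sin (2 * π * x) := by
    apply sin_pos_of_pos_of_lt_pi
    · positivity
    · nlinarith [pi_pos]
  have hb0 : 0 < b := by linarith
  have e3 : exp (-(3 * b)) ≤ 1 / 8 := by
    have h : exp (-(3 * b)) ≤ exp (-2.1) := by gcongr; linarith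
    refine h.trans ?_
    rw [exp_neg, inv_eq_one_div]
    apply one_div_le_one_div_of_le (by norm_num)
    rw [show (2.1 : ℝ) = 1 + 1 + 0.1 by norm_num, exp_add, exp_add]
    have h4 := exp_one_gt_d9
    have h5 := add_one_le_exp (0.1 : ℝ)
    calc (8 : ℝ) ≤ 2.7182 * 2.7182 * 1.1 := by norm_num
      _ ≤ _ := by gcongr <;> linarith
  have e4 : exp (-(3 * a)) ≤ 1 / 64 := by
    have h : exp (-(3 * a)) ≤ exp (-4.5) := by gcongr; linarith
    refine h.trans ?_
    rw [exp_neg, inv_eq_one_div]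
    apply one_div_le_one_div_of_le (by norm_num)
    rw [show (4.5 : ℝ) = 1 + 1 + 1 + 1 + 0.5 by norm_num, exp_add, exp_add, exp_add, exp_add]
    have h4 := exp_one_gt_d9
    have h5 := add_one_le_exp (0.5 : ℝ)
    calc (64 : ℝ) ≤ 2.7182 * 2.7182 * 2.7182 * 2.7182 * 1.5 := by norm_num
      _ ≤ _ := by gcongr <;> linarith
  -- lower bound for F
  have hF : exp (-b) * (sin (2 * π * x) - sin (2 * π * x) * (5 * exp (-(3 * b)))) ≤ FF b x := by
    have := (tsum_weight_ge (M := sin (2 * π * x)) hb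
      (fun k : ℕ => sin (2 * π * ((k : ℝ) + 1) * x)) ?_).2
    · simpa [FF] using this
    · intro k
      have h := abs_sin_nat_mul_le (k + 1) (2 * π * x)
      rw [abs_of_pos hs] at h
      push_cast at h
      rwa [show 2 * π * ((k : ℝ) + 1) * x = ((k : ℝ) + 1) * (2 * π * x) by ring]
  have hQ : QQ b ≤ exp (-b) * (1 + 5 * exp (-(3 * b))) := by
    unfold QQ
    rw [(summable_sq_exp hb0).tsum_eq_zero_add]
    have := tsum_tail_le hb
    have h2 : ∀ j : ℕ, (((j + 1 : ℕ) : ℝ) + 1) = (j : ℝ) + 2 := by intro j; push_cast; ring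
    simp only [h2]
    norm_num
    simp only [neg_mul] at this
    linarith
  have key := (tsum_weight_ge (a := a) (M := sin (2 * π * x) * QQ b) (by linarith)
    (fun n : ℕ => FF b (((n : ℝ) + 1) * x)) ?_).2
  · refine lt_of_lt_of_le ?_ key
    apply mul_pos (exp_pos _)
    simp only [Nat.cast_zero, zero_add, one_mul]
    have hQ' : QQ b ≤ exp (-b) * (13 / 8) := by
      refine hQ.trans ?_
      gcongr
      linarith
    have hF' : exp (-b) * (sin (2 * π * x) * (3 / 8)) ≤ FF b x := by
      refine le_trans ?_ hF
      gcongr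
      nlinarith
    have h1 : sin (2 * π * x) * QQ b * (5 * exp (-(3 * a))) ≤
        sin (2 * π * x) * (exp (-b) * (13 / 8)) * (5 * (1 / 64)) := by
      gcongr
    have : 0 < sin (2 * π * x) * exp (-b) := by positivity
    nlinarith
  · intro n
    have := FF_le hb0 x n
    rwa [abs_of_pos hs] at this

lemma phi_anti {c s r : ℝ} (hc : 14 ≤ c) (hs : 1 ≤ s) (hr : s ≤ r) :
    r * exp (-c * r ^ 2) ≤ s * exp (-c * s ^ 2) := by
  have h1 := add_one_le_exp (c * (r ^ 2 - s ^ 2))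
  have h2 : exp (-c * s ^ 2) = exp (c * (r ^ 2 - s ^ 2)) * exp (-c * r ^ 2) := by
    rw [← exp_add]; congr 1; ring
  rw [h2, ← mul_assoc]
  gcongr
  have h3 : r ≤ s * (c * (r ^ 2 - s ^ 2) + 1) := by
    have : (r - s) * 1 ≤ (r - s) * (s * c * (r + s)) := by
      apply mul_le_mul_of_nonneg_left _ (by linarith)
      nlinarith [mul_nonneg (by linarith : (0:ℝ) ≤ s - 1) (by linarith : (0:ℝ) ≤ c)]
    nlinarith
  exact h3.trans (by gcongr)

lemma odd_lower_right {c x h : ℝ} (hc : 14 ≤ c) (hx0 : 1 / 4 ≤ x) (hx1 : x ≤ 1 / 2)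
    (hh : HasSum (fun n : ℤ => ((n : ℝ) + x) * exp (-c * ((n : ℝ) + x) ^ 2)) h) :
    1 / 2 * exp (-(c / 4)) * (1 / 2 - x) ≤ h := by
  have H := hh.nat_add_neg_add_one
  have hterm : ∀ n : ℕ, n ≠ 0 → 0 ≤ (((n : ℤ) : ℝ) + x) * exp (-c * (((n : ℤ) : ℝ) + x) ^ 2) +
      (((-((n : ℤ) + 1) : ℤ) : ℝ) + x) * exp (-c * (((-((n : ℤ) + 1) : ℤ) : ℝ) + x) ^ 2) := by
    intro n hn
    have hn1 : (1 : ℝ) ≤ n := by exact_mod_cast Nat.one_le_iff_ne_zero.2 hn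
    have := phi_anti hc (s := n + x) (r := n + 1 - x) (by linarith) (by linarith)
    push_cast
    rw [show -((n : ℝ) + 1) + x = -(n + 1 - x) by ring, neg_sq]
    linarith
  have H0 := le_hasSum H 0 (fun n hn => hterm n hn)
  refine le_trans ?_ H0
  norm_num
  have e1 : exp (-(c * (-1 + x) ^ 2)) = exp (-(c * x ^ 2)) * exp (-(c * (1 - 2 * x))) := by
    rw [← exp_add]; congr 1; ring
  have e2 : exp (-(c / 4)) ≤ exp (-(c * x ^ 2)) := by
    have : x ^ 2 ≤ (1 / 2) ^ 2 := by gcongr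
    gcongr
    nlinarith
  set w := 1 - 2 * x with hw
  have hw0 : 0 ≤ w := by linarith
  have hw1 : w ≤ 1 / 2 := by linarith
  have hxw : x = (1 - w) / 2 := by linarith
  have e3 : (1 + 12 * w + 72 * w ^ 2) * exp (-(c * w)) ≤ 1 := by
    have h1 := quadratic_le_exp_of_nonneg (x := c * w) (by positivity)
    have h2 : exp (c * w) * exp (-(c * w)) = 1 := by rw [← exp_add]; simp
    rw [← h2]
    gcongr
    have : 12 * w ≤ c * w := by nlinarith
    nlinarith
  have e4 : 1 / 2 * (1 / 2 - x) ≤ x + (-1 + x) * exp (-(c * w)) := by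
    set e := exp (-(c * w))
    have he : 0 < e := exp_pos _
    have hp : 0 < 1 + 12 * w + 72 * w ^ 2 := by positivity
    have : e ≤ 1 / (1 + 12 * w + 72 * w ^ 2) := by rw [le_div_iff₀ hp]; linarith
    have h5 : (1 - x) * e ≤ (1 - x) * (1 / (1 + 12 * w + 72 * w ^ 2)) := by
      apply mul_le_mul_of_nonneg_left this; linarith
    have h6 : (1 - x) * (1 / (1 + 12 * w + 72 * w ^ 2)) ≤ x - 1 / 2 * (1 / 2 - x) := by
      rw [mul_one_div, div_le_iff₀ hp, hxw]
      nlinarith [mul_nonneg hw0 (by linarith : (0:ℝ) ≤ 1 / 2 - w), mul_nonneg (mul_nonneg hw0 hw0) (by linarith : (0:ℝ) ≤ 1 / 2 - w)]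
    linarith
  rw [e1]
  have e5 : exp (-(c / 4)) * (1 / 2 * (1 / 2 - x)) ≤
      exp (-(c * x ^ 2)) * (x + (-1 + x) * exp (-(c * w))) := by
    apply mul_le_mul e2 e4 _ (exp_pos _).le
    linarith
  linarith

lemma odd_lower_left {c x h : ℝ} (hc : 14 ≤ c) (hx0 : 0 ≤ x) (hx1 : x ≤ 1 / 4)
    (hh : HasSum (fun n : ℤ => ((n : ℝ) + x) * exp (-c * ((n : ℝ) + x) ^ 2)) h) :
    1 / 2 * exp (-(c / 4)) * x ≤ h := by
  have H := hh.nat_add_neg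
  rw [← hasSum_nat_add_iff' 1] at H
  have hr1 : exp (-(c / 2)) < 1 := by rw [exp_lt_one_iff]; linarith
  have hr0 := exp_pos (-(c / 2))
  have G := ((hasSum_geometric_of_lt_one hr0.le hr1).mul_left (80 * x * exp (-(c / 2)))).neg
  have hterm := hasSum_le ?_ G H
  · simp only [Finset.range_one, Finset.sum_singleton] at hterm
    norm_num at hterm
    have e7 : 162 * exp (-(c / 2)) ≤ exp (-(c / 16)) := by
      have : exp (-(c / 16)) = exp (7 * c / 16) * exp (-(c / 2)) := by
        rw [← exp_add]; congr 1; ring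
      rw [this]
      gcongr
      have h1 : exp 6 ≤ exp (7 * c / 16) := by gcongr; linarith
      refine le_trans ?_ h1
      rw [show (6 : ℝ) = 1 + 1 + 1 + 1 + 1 + 1 by norm_num]
      simp only [exp_add]
      have h4 := exp_one_gt_d9
      calc (162 : ℝ) ≤ 2.7 * 2.7 * 2.7 * 2.7 * 2.7 * 2.7 := by norm_num
        _ ≤ _ := by gcongr <;> linarith
    have e8 : exp (-(c / 16)) ≤ 1 := by rw [exp_le_one_iff]; linarith
    have e9 : 80 * x * exp (-(c / 2)) * (1 - exp (-(c / 2)))⁻¹ ≤ 81 * x * exp (-(c / 2)) := by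
      rw [← div_eq_mul_inv, div_le_iff₀ (by linarith)]
      have : 0 ≤ x * exp (-(c / 2)) := by positivity
      nlinarith
    have e10 : exp (-(c / 16)) ≤ exp (-(c * x ^ 2)) := by
      have : x ^ 2 ≤ (1 / 4) ^ 2 := by gcongr
      gcongr
      nlinarith
    have e11 : exp (-(c / 4)) ≤ exp (-(c / 16)) := by gcongr; linarith
    have e12 : x * exp (-(c / 16)) ≤ x * exp (-(c * x ^ 2)) := by gcongr
    have e13 : x * (162 * exp (-(c / 2))) ≤ x * exp (-(c / 16)) := by gcongr
    have e14 : x * exp (-(c / 4)) ≤ x * exp (-(c / 16)) := by gcongr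
    linarith
  · intro n
    push_cast
    set m : ℝ := (n : ℝ) + 1 with hm
    have hm1 : 1 ≤ m := by simp [hm]
    have f1 : exp (-c * (m + x) ^ 2) = exp (-(4 * c * m * x)) * exp (-c * (m - x) ^ 2) := by
      rw [← exp_add]; congr 1; ring
    rw [show -m + x = -(m - x) by ring, neg_sq, f1]
    have f2 := add_one_le_exp (-(4 * c * m * x))
    set E := exp (-c * (m - x) ^ 2) with hE
    have hE0 : 0 < E := exp_pos _
    have f3 : E ≤ exp (-(9 * c * m ^ 2 / 16)) := by
      rw [hE]
      gcongr
      have : (3 / 4 * m) ^ 2 ≤ (m - x) ^ 2 := by gcongr; linarith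
      nlinarith
    have f4 := add_one_le_exp (c * m ^ 2 / 16)
    have f5 : 5 * c * m ^ 2 * E ≤ 80 * exp (-(c / 2) * m) := by
      calc 5 * c * m ^ 2 * E ≤ (80 * exp (c * m ^ 2 / 16)) * exp (-(9 * c * m ^ 2 / 16)) := by
            apply mul_le_mul _ f3 hE0.le (by positivity)
            linarith
        _ = 80 * exp (-(c / 2) * m ^ 2) := by
            rw [mul_assoc, ← exp_add]; congr 2; ring
        _ ≤ _ := by
            have : -(c / 2) * m ^ 2 ≤ -(c / 2) * m := by
              nlinarith [mul_nonneg (by linarith : (0:ℝ) ≤ c) (mul_nonneg (by linarith : (0:ℝ) ≤ m) (by linarith : (0:ℝ) ≤ m - 1))]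
            gcongr
    have f6 : exp (-(c / 2)) * exp (-(c / 2)) ^ n = exp (-(c / 2) * m) := by
      rw [← exp_nat_mul, ← exp_add]; congr 1; rw [hm]; ring
    rw [mul_assoc (80 * x), f6]
    have f7 : (m + x) * (-(4 * c * m * x) + 1) ≤ (m + x) * exp (-(4 * c * m * x)) := by
      gcongr
    have f8 : -(5 * c * m ^ 2 * x) ≤ (m + x) * exp (-(4 * c * m * x)) - (m - x) := by
      have : c * m * x * x ≤ c * m * x * (m / 4) := by
        gcongr
        linarith
      nlinarith
    have f9 := mul_le_mul_of_nonneg_right f8 hE0.le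
    have f10 := mul_le_mul_of_nonneg_left f5 hx0
    linarith

lemma FF_eq {b : ℝ} (hb : 0 < b) (x : ℝ) :
    FF b x = 1 / 2 * HurwitzZeta.sinKernel (x : UnitAddCircle) (b / π) := by
  have h := HurwitzZeta.hasSum_nat_sinKernel x (t := b / π) (by positivity)
  rw [← hasSum_nat_add_iff' 1] at h
  simp only [Finset.range_one, Finset.sum_singleton, Nat.cast_zero, mul_zero, zero_mul,
    sub_zero] at h
  rw [← (h.mul_left (1 / 2)).tsum_eq]
  unfold FF
  refine tsum_congr fun k => ?_
  push_cast
  rw [show -π * ((k : ℝ) + 1) ^ 2 * (b / π) = -b * ((k : ℝ) + 1) ^ 2 by field_simp]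
  rw [show 2 * π * x * ((k : ℝ) + 1) = 2 * π * ((k : ℝ) + 1) * x by ring]
  ring

lemma FF_lower {b x d : ℝ} (hb : 0 < b) (hb1 : b ≤ 0.7) (hx0 : 0 ≤ x) (hx1 : x ≤ 1 / 2)
    (hd1 : d ≤ x) (hd2 : d ≤ 1 / 2 - x) (hd0 : 0 ≤ d) :
    (π ^ 2 / b) / (4 * π) * exp (-((π ^ 2 / b) / 4)) * d ≤ FF b x := by
  set c := π ^ 2 / b with hc
  have hpi := pi_gt_d2
  have hc14 : 14 ≤ c := by
    rw [hc, le_div_iff₀ hb]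
    nlinarith
  have h := HurwitzZeta.hasSum_int_oddKernel x (x := π / b) (by positivity)
  have h' : HasSum (fun n : ℤ => ((n : ℝ) + x) * exp (-c * ((n : ℝ) + x) ^ 2))
      (HurwitzZeta.oddKernel (x : UnitAddCircle) (π / b)) := by
    convert h using 4 with n
    rw [hc]; ring
  have hlow : 1 / 2 * exp (-(c / 4)) * d ≤
      HurwitzZeta.oddKernel (x : UnitAddCircle) (π / b) := by
    rcases le_total x (1 / 4) with hx | hx
    · refine le_trans ?_ (odd_lower_left hc14 hx0 hx h')
      gcongr
    · refine le_trans ?_ (odd_lower_right hc14 hx hx1 h')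
      gcongr
  have hfe := HurwitzZeta.oddKernel_functional_equation (x : UnitAddCircle) (π / b)
  rw [one_div_div] at hfe
  have hp : 0 < (π / b) ^ (3 / 2 : ℝ) := by positivity
  have hs : HurwitzZeta.sinKernel (x : UnitAddCircle) (b / π) =
      (π / b) ^ (3 / 2 : ℝ) * HurwitzZeta.oddKernel (x : UnitAddCircle) (π / b) := by
    rw [hfe]; field_simp
  have hge : π / b ≤ (π / b) ^ (3 / 2 : ℝ) := by
    have h1 : 1 ≤ π / b := by rw [le_div_iff₀ hb]; linarith
    calc π / b = (π / b) ^ (1 : ℝ) := (rpow_one _).symm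
      _ ≤ _ := rpow_le_rpow_of_exponent_le h1 (by norm_num)
  rw [FF_eq hb, hs]
  have hcp : π / b = c / π := by rw [hc]; field_simp
  calc c / (4 * π) * exp (-(c / 4)) * d
      = 1 / 2 * ((π / b) * (1 / 2 * exp (-(c / 4)) * d)) := by rw [hcp]; field_simp; ring
    _ ≤ _ := by gcongr

lemma core_II {a b x : ℝ} (hb : 0 < b) (hb1 : b ≤ 0.7) (hab : π ^ 2 / 4 ≤ a * b)
    (hx0 : 0 < x) (hx1 : x < 1 / 2) :
    0 < ∑' n : ℕ, ((n : ℝ) + 1) * exp (-a * ((n : ℝ) + 1) ^ 2) * FF b (((n : ℝ) + 1) * x) := by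
  set d := min x (1 / 2 - x) with hd
  have hd0 : 0 < d := lt_min hx0 (by linarith)
  have hpi := pi_gt_d2
  have hL := FF_lower hb hb1 hx0.le hx1.le (min_le_left _ _) (min_le_right _ _) hd0.le
  rw [← hd] at hL
  have hs : |sin (2 * π * x)| ≤ 2 * π * d := by
    rcases min_choice x (1 / 2 - x) with h | h
    · rw [hd, h]
      have := abs_sin_le_abs (x := 2 * π * x)
      rwa [abs_of_pos (a := 2 * π * x) (by positivity)] at this
    · rw [hd, h]
      have h2 : sin (2 * π * x) = sin (2 * π * (1 / 2 - x)) := by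
        rw [← sin_pi_sub]; congr 1; ring
      rw [h2]
      have := abs_sin_le_abs (x := 2 * π * (1 / 2 - x))
      rwa [abs_of_pos (a := 2 * π * (1 / 2 - x)) (mul_pos (by positivity) (by linarith))] at this
  have hQ : QQ b ≤ 4 / b ^ 2 := tsum_sq_exp_le hb
  set c := π ^ 2 / b with hc
  have hc14 : 14 ≤ c := by
    rw [hc, le_div_iff₀ hb]
    nlinarith
  have hca : c / 4 ≤ a := by
    rw [hc, div_div, mul_comm b 4, ← div_div, div_le_iff₀ hb]; exact hab
  have key := (tsum_weight_ge (a := a) (M := 2 * π * d * (4 / b ^ 2)) (by linarith)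
    (fun n : ℕ => FF b (((n : ℝ) + 1) * x)) ?_).2
  · refine lt_of_lt_of_le ?_ key
    apply mul_pos (exp_pos _)
    simp only [Nat.cast_zero, zero_add, one_mul]
    have h1 : exp (-(3 * a)) ≤ exp (-(c / 2)) * exp (-(c / 4)) := by
      rw [← exp_add]; gcongr; linarith
    have h2 : 4 / b ^ 2 = 4 * c ^ 2 / π ^ 4 := by rw [hc]; field_simp
    have h3 : 17 * c * exp (-(c / 2)) < 1 := by
      have q0 : exp (c / 2) * exp (-(c / 2)) = 1 := by rw [← exp_add]; simp
      rw [← q0]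
      gcongr
      have q1 : exp (c / 2) = exp 6 * exp (c / 2 - 6) := by rw [← exp_add]; congr 1; ring
      have q2 := add_one_le_exp (c / 2 - 6)
      have q3 : (380 : ℝ) ≤ exp 6 := by
        rw [show (6 : ℝ) = 1 + 1 + 1 + 1 + 1 + 1 by norm_num]
        simp only [exp_add]
        have h4 := exp_one_gt_d9
        calc (380 : ℝ) ≤ 2.7 * 2.7 * 2.7 * 2.7 * 2.7 * 2.7 := by norm_num
          _ ≤ _ := by gcongr <;> linarith
      rw [q1]
      calc 17 * c < 380 * (c / 2 - 6 + 1) := by linarith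
        _ ≤ _ := by
          apply mul_le_mul q3 q2 (by linarith) (exp_pos _).le
    have h4 : 160 * c * exp (-(c / 2)) < π ^ 2 := by
      nlinarith [exp_pos (-(c / 2))]
    have h5 : 2 * π * d * (4 / b ^ 2) * (5 * exp (-(3 * a))) ≤
        (160 * c * exp (-(c / 2)) / π ^ 2) * (c / (4 * π) * exp (-(c / 4)) * d) := by
      rw [h2]
      calc 2 * π * d * (4 * c ^ 2 / π ^ 4) * (5 * exp (-(3 * a)))
          ≤ 2 * π * d * (4 * c ^ 2 / π ^ 4) * (5 * (exp (-(c / 2)) * exp (-(c / 4)))) := by gcongr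
        _ = _ := by field_simp; ring
    have h6 : 160 * c * exp (-(c / 2)) / π ^ 2 < 1 := by
      rw [div_lt_one (by positivity)]; exact h4
    have h7 : 0 < c / (4 * π) * exp (-(c / 4)) * d := by positivity
    nlinarith
  · intro n
    refine (FF_le hb x n).trans ?_
    have hQ0 : 0 ≤ QQ b := tsum_nonneg fun n => by positivity
    gcongr

/-- The double sum. -/
def TT (a b x : ℝ) (p : ℕ × ℕ) : ℝ :=
  (((p.1 : ℝ) + 1) * exp (-a * ((p.1 : ℝ) + 1) ^ 2)) *
    (((p.2 : ℝ) + 1) * exp (-b * ((p.2 : ℝ) + 1) ^ 2)) *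
    sin (2 * π * (((p.1 : ℝ) + 1) * ((p.2 : ℝ) + 1)) * x)

lemma summable_lin_exp {a : ℝ} (ha : 0 < a) :
    Summable fun n : ℕ => ((n : ℝ) + 1) * exp (-a * ((n : ℝ) + 1) ^ 2) := by
  refine Summable.of_nonneg_of_le (fun n => by positivity) (fun n => ?_) (summable_sq_exp ha)
  gcongr
  nlinarith [(Nat.cast_nonneg n : (0:ℝ) ≤ n)]

lemma summable_dbl {a b : ℝ} (ha : 0 < a) (hb : 0 < b) :
    Summable fun p : ℕ × ℕ => (((p.1 : ℝ) + 1) * exp (-a * ((p.1 : ℝ) + 1) ^ 2)) *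
      (((p.2 : ℝ) + 1) * exp (-b * ((p.2 : ℝ) + 1) ^ 2)) :=
  (summable_lin_exp ha).mul_of_nonneg (summable_lin_exp hb)
    (fun n => by positivity) (fun n => by positivity)

lemma TT_le (a b x : ℝ) (p : ℕ × ℕ) : ‖TT a b x p‖ ≤
    (((p.1 : ℝ) + 1) * exp (-a * ((p.1 : ℝ) + 1) ^ 2)) *
      (((p.2 : ℝ) + 1) * exp (-b * ((p.2 : ℝ) + 1) ^ 2)) := by
  unfold TT
  rw [norm_mul, norm_of_nonneg (by positivity)]
  exact mul_le_of_le_one_right (by positivity) (abs_sin_le_one _)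

lemma summable_TT {a b : ℝ} (ha : 0 < a) (hb : 0 < b) (x : ℝ) : Summable (TT a b x) :=
  Summable.of_norm_bounded (summable_dbl ha hb) (TT_le a b x)

lemma tsum_TT {a b : ℝ} (ha : 0 < a) (hb : 0 < b) (x : ℝ) : ∑' p, TT a b x p =
    ∑' n : ℕ, ((n : ℝ) + 1) * exp (-a * ((n : ℝ) + 1) ^ 2) * FF b (((n : ℝ) + 1) * x) := by
  rw [(summable_TT ha hb x).tsum_prod]
  refine tsum_congr fun n => ?_
  unfold FF TT
  rw [← tsum_mul_left]
  refine tsum_congr fun k => ?_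
  simp only []
  rw [mul_assoc]
  congr 3
  ring

lemma tsum_TT_symm (a b x : ℝ) : ∑' p, TT a b x p = ∑' p, TT b a x p := by
  rw [← (Equiv.prodComm ℕ ℕ).tsum_eq (TT a b x)]
  refine tsum_congr fun p => ?_
  simp only [TT, Equiv.prodComm_apply, Prod.fst_swap, Prod.snd_swap]
  rw [mul_comm ((p.2 : ℝ) + 1) ((p.1 : ℝ) + 1)]
  ring

lemma core_ordered {a b x : ℝ} (hb : 0 < b) (hba : b ≤ a) (hab : π ^ 2 / 4 ≤ a * b)
    (hx0 : 0 < x) (hx1 : x < 1 / 2) : 0 < ∑' p, TT a b x p := by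
  rw [tsum_TT (hb.trans_le hba) hb]
  rcases le_total b 0.7 with h | h
  · exact core_II hb h hab hx0 hx1
  · refine core_I ?_ h hx0 hx1
    have hpi := pi_gt_d2
    by_contra hlt
    push Not at hlt
    nlinarith

lemma core {a b x : ℝ} (ha : 0 < a) (hb : 0 < b) (hab : π ^ 2 / 4 ≤ a * b)
    (hx0 : 0 < x) (hx1 : x < 1 / 2) : 0 < ∑' p, TT a b x p := by
  rcases le_total b a with h | h
  · exact core_ordered hb h hab hx0 hx1
  · rw [tsum_TT_symm]
    exact core_ordered ha h (by linarith) hx0 hx1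

lemma summable_exp_sq {a : ℝ} (ha : 0 < a) :
    Summable fun n : ℕ => exp (-a * ((n : ℝ) + 1) ^ 2) := by
  refine Summable.of_nonneg_of_le (fun n => by positivity) (fun n => ?_) (summable_lin_exp ha)
  exact le_mul_of_one_le_left (exp_pos _).le (by simp)

def UU (a b x : ℝ) (p : ℕ × ℕ) : ℝ :=
  exp (-a * ((p.1 : ℝ) + 1) ^ 2) * exp (-b * ((p.2 : ℝ) + 1) ^ 2) *
    cos (2 * π * (((p.1 : ℝ) + 1) * ((p.2 : ℝ) + 1)) * x)

lemma summable_UU {a b : ℝ} (ha : 0 < a) (hb : 0 < b) (x : ℝ) : Summable (UU a b x) := by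
  refine Summable.of_norm_bounded ((summable_exp_sq ha).mul_of_nonneg (summable_exp_sq hb)
    (fun n => by positivity) (fun n => by positivity)) (fun p => ?_)
  unfold UU
  rw [norm_mul, norm_of_nonneg (by positivity)]
  exact mul_le_of_le_one_right (by positivity) (abs_cos_le_one _)

lemma hasDerivAt_UU {a b : ℝ} (ha : 0 < a) (hb : 0 < b) (x : ℝ) :
    HasDerivAt (fun z => ∑' p, UU a b z p) (-(2 * π) * ∑' p, TT a b x p) x := by
  rw [← tsum_mul_left]
  refine hasDerivAt_tsum (u := fun p : ℕ × ℕ => (2 * π) *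
      ((((p.1 : ℝ) + 1) * exp (-a * ((p.1 : ℝ) + 1) ^ 2)) *
      (((p.2 : ℝ) + 1) * exp (-b * ((p.2 : ℝ) + 1) ^ 2))))
    (g' := fun p z => -(2 * π) * TT a b z p) (y₀ := x)
    ((summable_dbl ha hb).mul_left _) ?_ ?_ (summable_UU ha hb x) x
  · intro p z
    unfold UU TT
    have h1 : HasDerivAt (fun z : ℝ => 2 * π * (((p.1 : ℝ) + 1) * ((p.2 : ℝ) + 1)) * z)
        (2 * π * (((p.1 : ℝ) + 1) * ((p.2 : ℝ) + 1))) z := by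
      simpa using (hasDerivAt_id z).const_mul (2 * π * (((p.1 : ℝ) + 1) * ((p.2 : ℝ) + 1)))
    refine (h1.cos.const_mul (exp (-a * ((p.1 : ℝ) + 1) ^ 2) *
      exp (-b * ((p.2 : ℝ) + 1) ^ 2))).congr_deriv ?_
    ring
  · intro p z
    rw [norm_mul, norm_neg, norm_of_nonneg (by positivity : 0 ≤ 2 * π)]
    gcongr
    exact TT_le a b z p

lemma hasSum_cos {a b : ℝ} (ha : 0 < a) (hb : 0 < b) (x : ℝ) :
    HasSum (fun n : ℕ => exp (-a * ((n : ℝ) + 1) ^ 2) *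
      HurwitzZeta.cosKernel ((((n : ℝ) + 1) * x : ℝ) : UnitAddCircle) (b / π))
      (2 * ∑' p, UU a b x p + ∑' n : ℕ, exp (-a * ((n : ℝ) + 1) ^ 2)) := by
  have h1 : ∀ n : ℕ, HasSum (fun k : ℕ => UU a b x (n, k))
      (exp (-a * ((n : ℝ) + 1) ^ 2) * (1 / 2) *
        (HurwitzZeta.cosKernel ((((n : ℝ) + 1) * x : ℝ) : UnitAddCircle) (b / π) - 1)) := by
    intro n
    have h := (HurwitzZeta.hasSum_nat_cosKernel₀ (((n : ℝ) + 1) * x) (t := b / π)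
      (by positivity)).mul_left (exp (-a * ((n : ℝ) + 1) ^ 2) * (1 / 2))
    refine h.congr_fun fun k => ?_
    unfold UU
    simp only []
    rw [show -π * ((k : ℝ) + 1) ^ 2 * (b / π) = -b * ((k : ℝ) + 1) ^ 2 by field_simp,
      show 2 * π * (((n : ℝ) + 1) * x) * ((k : ℝ) + 1) =
        2 * π * (((n : ℝ) + 1) * ((k : ℝ) + 1)) * x by ring]
    ring
  have h2 := (summable_UU ha hb x).hasSum.prod_fiberwise h1
  refine ((h2.mul_left 2).add (summable_exp_sq ha).hasSum).congr_fun fun n => ?_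
  ring

lemma theta_eq {t y : ℝ} (ht : 0 < t) (hy : 0 < y) : ∃ C A : ℝ, 0 < C ∧ ∀ x : ℝ,
    theta t x y = C * ∑' p, UU (t * y) (π ^ 2 * y / t) x p + A := by
  set a := t * y with ha'
  set b := π ^ 2 * y / t with hb'
  have ha : 0 < a := by positivity
  have hb : 0 < b := by positivity
  set X := t / (y * π) with hX'
  have hX : 0 < X := by positivity
  have hX1 : 1 / X = b / π := by rw [hX', hb']; field_simp
  set C := 1 / X ^ (1 / 2 : ℝ) with hC'
  have hC : 0 < C := by positivity
  refine ⟨4 * C, 2 * C * (∑' n : ℕ, exp (-a * ((n : ℝ) + 1) ^ 2)) +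
    C * HurwitzZeta.cosKernel ((0 : ℝ) : UnitAddCircle) (b / π) - 1, by positivity, fun x => ?_⟩
  set g : ℤ → ℝ := fun n => exp (-a * (n : ℝ) ^ 2) *
    HurwitzZeta.evenKernel (((n : ℝ) * x : ℝ) : UnitAddCircle) X with hg
  have hK : ∀ u : UnitAddCircle, HurwitzZeta.evenKernel u X =
      C * HurwitzZeta.cosKernel u (b / π) := by
    intro u
    rw [HurwitzZeta.evenKernel_functional_equation, hX1]
  have hc := (hasSum_cos ha hb x).mul_left C
  have hg1 : HasSum (fun n : ℕ => g (n + 1)) (C * (2 * ∑' p, UU a b x p +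
      ∑' n : ℕ, exp (-a * ((n : ℝ) + 1) ^ 2))) := by
    refine hc.congr_fun fun n => ?_
    simp only [hg]
    rw [hK]
    push_cast
    ring
  have hg2 : HasSum (fun n : ℕ => g (-(n + 1))) (C * (2 * ∑' p, UU a b x p +
      ∑' n : ℕ, exp (-a * ((n : ℝ) + 1) ^ 2))) := by
    refine hg1.congr_fun fun n => ?_
    simp only [hg]
    push_cast
    rw [neg_mul (_ + 1 : ℝ) x, AddCircle.coe_neg, HurwitzZeta.evenKernel_neg, neg_sq]
  have hG := HasSum.of_add_one_of_neg_add_one hg1 hg2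
  -- the full double sum
  set f : ℤ × ℤ → ℝ := fun p =>
    exp (-(t / y) * (((p.1 : ℝ) + (p.2 : ℝ) * x) ^ 2 + (p.2 : ℝ) ^ 2 * y ^ 2)) with hf
  have hfib : ∀ n : ℤ, HasSum (fun m : ℤ => f (m, n)) (g n) := by
    intro n
    have h := (HurwitzZeta.hasSum_int_evenKernel ((n : ℝ) * x) hX).mul_left
      (exp (-a * (n : ℝ) ^ 2))
    refine h.congr_fun fun m => ?_
    simp only [hf]
    rw [← exp_add]
    congr 1
    rw [ha', hX']
    field_simp
    ring
  have hswap : Summable (fun p : ℤ × ℤ => f (p.2, p.1)) := by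
    rw [summable_prod_of_nonneg (fun p => (exp_pos _).le)]
    refine ⟨fun n => (hfib n).summable, ?_⟩
    exact hG.summable.congr fun n => (hfib n).tsum_eq.symm
  have hS1 : HasSum (fun p : ℤ × ℤ => f (p.2, p.1)) _ := hswap.hasSum
  have hS2 := hS1.prod_fiberwise hfib
  have hSval := hS2.unique hG
  have hS : HasSum f (∑' p : ℤ × ℤ, f (p.2, p.1)) :=
    (Equiv.prodComm ℤ ℤ).hasSum_iff.1 hS1
  have hsub := (hasSum_ite_sub_hasSum hS (0, 0)).tsum_eq
  have hth : theta t x y = ∑' p : ℤ × ℤ, if p = (0, 0) then 0 else f p := by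
    unfold theta
    have := tsum_subtype {p : ℤ × ℤ | p ≠ (0, 0)} f
    refine Eq.trans this (tsum_congr fun p => ?_)
    by_cases hp : p = (0, 0) <;> simp [Set.indicator, hp]
  rw [hth, hsub, hSval]
  have hf0 : f (0, 0) = 1 := by simp [hf]
  have hg0 : g 0 = C * HurwitzZeta.cosKernel ((0 : ℝ) : UnitAddCircle) (b / π) := by
    simp only [hg]
    rw [hK]
    simp
  rw [hf0, hg0]
  ring

/-- Montgomery's first monotonicity property: for `t > 0`, `y ≥ 1/2` and
`0 < x < 1/2`, the function `x ↦ θ(t; x, y)` is strictly decreasing, in the sense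
that its derivative in `x` is strictly negative. -/
theorem theta_deriv_x_neg
    (t : ℝ) (ht : 0 < t) (y : ℝ) (hy : 1 / 2 ≤ y)
    (x : ℝ) (hx0 : 0 < x) (hx1 : x < 1 / 2) :
    deriv (fun x' : ℝ => theta t x' y) x < 0 := by
  have hy0 : 0 < y := by linarith
  obtain ⟨C, A, hC, h⟩ := theta_eq ht hy0
  have ha : 0 < t * y := by positivity
  have hb : 0 < π ^ 2 * y / t := by positivity
  have hd := ((hasDerivAt_UU ha hb x).const_mul C).add_const A
  have hfun : (fun x' : ℝ => theta t x' y) =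
      fun z => C * ∑' p, UU (t * y) (π ^ 2 * y / t) z p + A := funext h
  rw [hfun, hd.deriv]
  have hpos := core ha hb (x := x) (by
    rw [show t * y * (π ^ 2 * y / t) = π ^ 2 * y ^ 2 by field_simp]
    have : (1 / 2 : ℝ) ^ 2 ≤ y ^ 2 := by gcongr
    nlinarith [sq_nonneg π]) hx0 hx1
  have : 0 < C * (2 * π * ∑' p, TT (t * y) (π ^ 2 * y / t) x p) := by positivity
  linarith
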